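/- Mass splitting of perimeter-minimizing sequences with converging (not fixed) volumes: Let (X, d, μ) be a noncompact metric measure space satisfying (H1)–(H5), and assume moreover that the isoperimetric profile I_X is real-valued and continuous on (0, μ(X)). Fix x ∈ X and V ∈ (0, μ(X)), and let Ω_k ⊆ X be Borel sets with lim_k μ(Ω_k) = V and lim_k P(Ω_k) = I_X(V). Then, up to passing to a subsequence, there exist a set of finite perimeter Ω ⊆ X and a diverging sequence of radii r_k → +∞ such that, setting Ω_k^c := Ω_k ∩ B_{r_k}(x) and Ω_k^d := Ω_k ∖ B_{r_k}(x): (i) lim_k (P(Ω_k^c) + P(Ω_k^d)) = I_X(V); (ii) χ_{Ω_k^c} → χ_Ω in L¹(B, μ) for every ball B ⊆ X; (iii) Ω is an isoperimetric region, i.e. P(Ω) = I_X(μ(Ω)), and moreover lim_k μ(Ω_k^c) = μ(Ω) and lim_k P(Ω_k^c) = P(Ω). -/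

import Mathlib

open Filter MeasureTheory Metric Set Topology
open scoped ENNReal NNReal

noncomputable section

variable {X : Type*} [MetricSpace X] [MeasurableSpace X]

/-- `u` is locally Lipschitz on the set `A`. -/
def LocLipschitzOn (u : X → ℝ) (A : Set X) : Prop :=
  ∀ x ∈ A, ∃ K : NNReal, ∃ t ∈ 𝓝[A] x, LipschitzOnWith K u t

/-- The slope `lip u (x)` of `u` at `x` (equal to `0` at isolated points). -/
def lipSlope (u : X → ℝ) (x : X) : ℝ≥0∞ :=
  Filter.limsup (fun y => ENNReal.ofReal (|u y - u x| / dist y x)) (𝓝[≠] x)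

/-- Convergence `u i → f` in `L¹(B, μ)`. -/
def TendstoL1On (μ : Measure X) (B : Set X) (u : ℕ → X → ℝ) (f : X → ℝ) : Prop :=
  Tendsto (fun i => ∫⁻ x in B, ENNReal.ofReal |u i x - f x| ∂μ) atTop (𝓝 0)

/-- Convergence `u i → f` in `L¹_loc(A, μ)`, i.e. in `L¹(K, μ)` for every compact `K ⊆ A`. -/
def TendstoL1LocOn (μ : Measure X) (A : Set X) (u : ℕ → X → ℝ) (f : X → ℝ) : Prop :=
  ∀ K : Set X, K ⊆ A → IsCompact K → TendstoL1On μ K u f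

/-- The relative perimeter `P(E, A)` of a Borel set `E` in an open set `A`. -/
def perim (μ : Measure X) (E A : Set X) : ℝ≥0∞ :=
  ⨅ (u : ℕ → X → ℝ) (_ : ∀ i, LocLipschitzOn (u i) A)
    (_ : TendstoL1LocOn μ A u (E.indicator 1)),
    Filter.liminf (fun i => ∫⁻ x in A, lipSlope (u i) x ∂μ) atTop

/-- The perimeter `P(E) := P(E, X)`. -/
def Perim (μ : Measure X) (E : Set X) : ℝ≥0∞ := perim μ E Set.univ

/-- The isoperimetric profile `I_X`. -/
def isoProfile (μ : Measure X) (V : ℝ) : ℝ≥0∞ :=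
  ⨅ (E : Set X) (_ : MeasurableSet E) (_ : μ E = ENNReal.ofReal V), Perim μ E

/-- The measure is finite on bounded sets. -/
def FiniteOnBounded (μ : Measure X) : Prop :=
  ∀ s : Set X, Bornology.IsBounded s → μ s < ⊤

/-- The support of the measure is the whole space. -/
def FullSupport (μ : Measure X) : Prop :=
  ∀ (x : X) (r : ℝ), 0 < r → 0 < μ (ball x r)

/-- (H1) BV compactness. -/
def BVCompactness (μ : Measure X) : Prop :=
  ∀ E : ℕ → Set X, (∀ i, MeasurableSet (E i)) →
    (∃ M : ℝ≥0∞, M ≠ ⊤ ∧ ∀ i, μ (E i) + Perim μ (E i) ≤ M) →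
    ∃ φ : ℕ → ℕ, StrictMono φ ∧ ∃ F : Set X, MeasurableSet F ∧
      ∀ (x : X) (r : ℝ), 0 < r →
        TendstoL1On μ (ball x r) (fun k => (E (φ k)).indicator 1) (F.indicator 1)

/-- (H2) Cut property. -/
def CutProperty (μ : Measure X) : Prop :=
  ∀ E : Set X, MeasurableSet E → Perim μ E ≠ ⊤ → ∀ o : X,
    ∀ᵐ r ∂(volume.restrict (Set.Ioi (0:ℝ))),
      Perim μ (E ∩ ball o r) ≤ perim μ E (ball o r) +
          ENNReal.ofReal (deriv (fun s => (μ (E ∩ ball o s)).toReal) r) ∧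
      Perim μ (E \ ball o r) ≤ perim μ E (closure (ball o r))ᶜ +
          ENNReal.ofReal (deriv (fun s => (μ (E ∩ ball o s)).toReal) r)

/-- (H3) The perimeter of balls of radius `r` vanishes uniformly as `r → 0⁺`. -/
def SmallBallPerimeter (μ : Measure X) : Prop :=
  Tendsto (fun r : ℝ => ⨆ x : X, Perim μ (ball x r)) (𝓝[>] 0) (𝓝 0)

/-- (H4) Continuity of the volume of balls. -/
def BallVolContinuous (μ : Measure X) : Prop :=
  ∀ x : X, ContinuousOn (fun r : ℝ => (μ (ball x r)).toReal) (Set.Ioi (0:ℝ))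

/-- (H5) `μ` is uniformly locally doubling. -/
def UnifLocDoubling (μ : Measure X) : Prop :=
  ∀ R : ℝ, 0 < R → ∃ C : ℝ≥0∞, C ≠ ⊤ ∧
    ∀ (x : X) (r : ℝ), 0 < r → r ≤ R → μ (ball x (2*r)) ≤ C * μ (ball x r)

/-- The isoperimetric profile at infinity `I^∞_X`. -/
def isoProfileAtInfty (μ : Measure X) (V : ℝ) : ℝ≥0∞ :=
  ⨅ (E : ℕ → Set X) (_ : ∀ i, MeasurableSet (E i))
    (_ : Tendsto (fun i => μ (E i)) atTop (𝓝 (ENNReal.ofReal V)))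
    (_ : ∀ (x : X) (r : ℝ), 0 < r → ∀ᶠ i in atTop, E i ∩ ball x r = ∅),
    Filter.liminf (fun i => Perim μ (E i)) atTop

/-- The isoperimetric profile at infinity volumewise `Ĩ^∞_X`. -/
def isoProfileAtInftyVol (μ : Measure X) (V : ℝ) : ℝ≥0∞ :=
  ⨅ (E : ℕ → Set X) (_ : ∀ i, MeasurableSet (E i))
    (_ : Tendsto (fun i => μ (E i)) atTop (𝓝 (ENNReal.ofReal V)))
    (_ : ∀ (x : X) (r : ℝ), 0 < r →
      Tendsto (fun i => μ (E i ∩ ball x r)) atTop (𝓝 0)),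
    Filter.liminf (fun i => Perim μ (E i)) atTop

/-- The open interval `(0, μ(X))` of admissible volumes. -/
def profileDomain (μ : Measure X) : Set ℝ :=
  {V : ℝ | 0 < V ∧ ENNReal.ofReal V < μ Set.univ}


theorem ENNReal.liminf_add_liminf_le (u v : ℕ → ℝ≥0∞) :
    liminf u atTop + liminf v atTop ≤ liminf (fun n => u n + v n) atTop := by
  have hmono (w : ℕ → ℝ≥0∞) : Monotone fun n => ⨅ i ≥ n, w i := fun m n hmn =>
    le_iInf₂ fun i hi => iInf₂_le i (hmn.trans hi)
  rw [liminf_eq_iSup_iInf_of_nat, liminf_eq_iSup_iInf_of_nat, liminf_eq_iSup_iInf_of_nat,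
    ENNReal.iSup_add_iSup_of_monotone (hmono u) (hmono v)]
  exact iSup_mono fun n => le_iInf₂ fun i hi => add_le_add (iInf₂_le i hi) (iInf₂_le i hi)

theorem ENNReal.limsup_add_liminf_le (u v : ℕ → ℝ≥0∞) :
    limsup u atTop + liminf v atTop ≤ limsup (fun n => u n + v n) atTop := by
  rw [liminf_eq_iSup_iInf_of_nat, ENNReal.add_iSup]
  refine iSup_le fun n => ?_
  rw [← limsup_add_const atTop u _ (by isBoundedDefault) (by isBoundedDefault)]
  refine limsup_le_limsup ?_
  filter_upwards [eventually_ge_atTop n] with i hi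
  gcongr
  exact iInf₂_le i hi

theorem lipSlope_sup_le {Y : Type*} [MetricSpace Y] (u v : Y → ℝ) (x : Y) :
    lipSlope (fun y => max (u y) (v y)) x ≤ lipSlope u x + lipSlope v x := by
  refine le_trans ?_
    (max_le_add_of_nonneg (zero_le (a := lipSlope u x)) (zero_le (a := lipSlope v x)))
  unfold lipSlope
  rw [← limsup_max]
  refine limsup_le_limsup (Eventually.of_forall fun y => ?_)
  dsimp only
  rw [← ENNReal.ofReal_max, max_div_div_right dist_nonneg]
  gcongr
  exact abs_max_sub_max_le_max _ _ _ _

theorem measurable_lipSlope [OpensMeasurableSpace X] {u : X → ℝ} (hu : Continuous u) :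
    Measurable (lipSlope u) := by
  have h : lipSlope u = fun x => ⨅ n : ℕ, ⨆ y ∈ ball x (1 / ((n : ℝ) + 1)) ∩ {x}ᶜ,
      ENNReal.ofReal (|u y - u x| / dist y x) := by
    funext x
    have := (nhdsWithin_hasBasis (nhds_basis_ball_inv_nat_succ (x := x)) {x}ᶜ).limsup_eq_iInf_iSup
      (u := fun y => ENNReal.ofReal (|u y - u x| / dist y x))
    simpa [lipSlope] using this
  rw [h]
  refine Measurable.iInf fun n => LowerSemicontinuous.measurable fun x c hc => ?_
  simp only [lt_iSup_iff] at hc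
  obtain ⟨y, ⟨hy1, hy2⟩, hy⟩ := hc
  have hyx : dist y x ≠ 0 := by simpa [dist_eq_zero] using hy2
  have hcont : ContinuousAt (fun z => ENNReal.ofReal (|u y - u z| / dist y z)) x := by
    refine ENNReal.continuous_ofReal.continuousAt.comp ?_
    exact ContinuousAt.div (by fun_prop) (by fun_prop) hyx
  have hd : ContinuousAt (fun z => dist y z) x := by fun_prop
  filter_upwards [hcont.eventually_const_lt hy, hd.eventually_lt_const (mem_ball.1 hy1),
    hd.eventually_ne hyx] with z h1 h2 h3
  exact h1.trans_le (le_iSup₂_of_le y ⟨mem_ball.2 h2, by simpa [dist_eq_zero] using h3⟩ le_rfl)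

theorem LocLipschitzOn.continuous {Y : Type*} [MetricSpace Y] {u : Y → ℝ}
    (hu : LocLipschitzOn u univ) : Continuous u := by
  refine continuous_iff_continuousAt.2 fun x => ?_
  obtain ⟨K, t, ht, hK⟩ := hu x (mem_univ x)
  rw [nhdsWithin_univ] at ht
  exact hK.continuousOn.continuousAt ht

theorem LocLipschitzOn.mono {Y : Type*} [MetricSpace Y] {u : Y → ℝ} {A B : Set Y}
    (hu : LocLipschitzOn u B) (hAB : A ⊆ B) : LocLipschitzOn u A := fun x hx =>
  let ⟨K, t, ht, hK⟩ := hu x (hAB hx)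
  ⟨K, t, nhdsWithin_mono x hAB ht, hK⟩

theorem LocLipschitzOn.sup {Y : Type*} [MetricSpace Y] {u v : Y → ℝ} {A : Set Y}
    (hu : LocLipschitzOn u A) (hv : LocLipschitzOn v A) :
    LocLipschitzOn (fun y => max (u y) (v y)) A := by
  intro x hx
  obtain ⟨K, s, hs, hK⟩ := hu x hx
  obtain ⟨L, t, ht, hL⟩ := hv x hx
  refine ⟨max K L, s ∩ t, inter_mem hs ht, LipschitzOnWith.of_dist_le_mul fun y hy z hz => ?_⟩
  rw [Real.dist_eq, NNReal.coe_max, max_mul_of_nonneg _ _ dist_nonneg]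
  refine (abs_max_sub_max_le_max _ _ _ _).trans (max_le_max ?_ ?_)
  · simpa [Real.dist_eq] using hK.dist_le_mul y hy.1 z hz.1
  · simpa [Real.dist_eq] using hL.dist_le_mul y hy.2 z hz.2

/-- Relative perimeters in disjoint open sets add up to at most the full perimeter. -/
theorem perim_add_perim_le [OpensMeasurableSpace X] (μ : Measure X) (E : Set X) {A B : Set X}
    (hB : IsOpen B) (hAB : Disjoint A B) : perim μ E A + perim μ E B ≤ Perim μ E := by
  refine le_iInf fun u => le_iInf₂ fun hu hconv => ?_
  have h (S : Set X) : perim μ E S ≤ liminf (fun i => ∫⁻ x in S, lipSlope (u i) x ∂μ) atTop :=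
    iInf_le_of_le u <| iInf₂_le (fun i => (hu i).mono (subset_univ S))
      (fun K _ hK => hconv K (subset_univ K) hK)
  refine (add_le_add (h A) (h B)).trans ((ENNReal.liminf_add_liminf_le _ _).trans ?_)
  refine liminf_le_liminf (Eventually.of_forall fun i => ?_)
  rw [← lintegral_union hB.measurableSet hAB]
  exact lintegral_mono_set (subset_univ _)

/-- An approximating sequence whose energies all lie below a prescribed bound. -/
theorem exists_approx_of_perim_lt {μ : Measure X} {E : Set X} {c : ℝ≥0∞} (h : Perim μ E < c) :
    ∃ u : ℕ → X → ℝ, (∀ i, LocLipschitzOn (u i) univ) ∧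
      TendstoL1LocOn μ univ u (E.indicator 1) ∧ ∀ i, ∫⁻ x, lipSlope (u i) x ∂μ < c := by
  simp only [Perim, perim, iInf_lt_iff, Measure.restrict_univ] at h
  obtain ⟨u, hu, hconv, hlt⟩ := h
  obtain ⟨θ, hθ, hθlt⟩ := extraction_of_frequently_atTop
    (frequently_lt_of_liminf_lt (by isBoundedDefault) hlt)
  exact ⟨fun i => u (θ i), fun i => hu _,
    fun K hK hKc => (hconv K hK hKc).comp hθ.tendsto_atTop, hθlt⟩

theorem perim_le_of_approx {μ : Measure X} {E : Set X} {c : ℝ≥0∞} {u : ℕ → X → ℝ}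
    (hu : ∀ i, LocLipschitzOn (u i) univ) (hconv : TendstoL1LocOn μ univ u (E.indicator 1))
    (hc : ∀ i, ∫⁻ x, lipSlope (u i) x ∂μ ≤ c) : Perim μ E ≤ c := by
  refine iInf_le_of_le u (iInf₂_le_of_le hu hconv ?_)
  simp only [Measure.restrict_univ]
  exact (liminf_le_liminf (Eventually.of_forall hc)).trans (liminf_const c).le

theorem lintegral_indicator_sub_eq {Y : Type*} [MeasurableSpace Y] {μ : Measure Y}
    {E F : Set Y} (hE : MeasurableSet E) (hF : MeasurableSet F) (B : Set Y) :
    ∫⁻ x in B, ENNReal.ofReal |E.indicator (1 : Y → ℝ) x - F.indicator 1 x| ∂μ =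
      μ (symmDiff E F ∩ B) := by
  have hEF : MeasurableSet (symmDiff E F) := hE.symmDiff hF
  rw [← Measure.restrict_apply hEF, ← lintegral_indicator_one hEF]
  refine lintegral_congr fun x => ?_
  by_cases h1 : x ∈ E <;> by_cases h2 : x ∈ F <;> simp [h1, h2, mem_symmDiff]

theorem lintegral_abs_sub_le {Y : Type*} [MeasurableSpace Y] {μ : Measure Y} (f : Y → ℝ)
    {g h : Y → ℝ} (hg : Measurable g) (hh : Measurable h) :
    ∫⁻ x, ENNReal.ofReal |f x - h x| ∂μ ≤
      ∫⁻ x, ENNReal.ofReal |f x - g x| ∂μ + ∫⁻ x, ENNReal.ofReal |g x - h x| ∂μ := by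
  rw [← lintegral_add_right _ (by fun_prop)]
  refine lintegral_mono fun x => ?_
  rw [← ENNReal.ofReal_add (abs_nonneg _) (abs_nonneg _)]
  exact ENNReal.ofReal_le_ofReal (abs_sub_le _ _ _)

theorem perim_union_le [OpensMeasurableSpace X] (μ : Measure X) {E F : Set X}
    (hE : MeasurableSet E) : Perim μ (E ∪ F) ≤ Perim μ E + Perim μ F := by
  refine ENNReal.le_of_forall_pos_le_add fun ε hε hfin => ?_
  have hε' : (0 : ℝ≥0∞) < ε / 2 := by simpa using hε.ne'
  obtain ⟨hEfin, hFfin⟩ := ENNReal.add_lt_top.1 hfin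
  obtain ⟨u, hu, huE, hul⟩ := exists_approx_of_perim_lt
    (ENNReal.lt_add_right hEfin.ne hε'.ne')
  obtain ⟨v, hv, hvF, hvl⟩ := exists_approx_of_perim_lt
    (ENNReal.lt_add_right hFfin.ne hε'.ne')
  refine perim_le_of_approx (u := fun i y => max (u i y) (v i y)) (fun i => (hu i).sup (hv i))
    (fun K hK hKc => ?_) (fun i => ?_)
  · have hsum := (huE K hK hKc).add (hvF K hK hKc)
    rw [add_zero] at hsum
    refine tendsto_of_tendsto_of_tendsto_of_le_of_le tendsto_const_nhds hsum
      (fun _ => zero_le) fun i => ?_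
    have hm : Measurable fun x => ENNReal.ofReal |u i x - E.indicator 1 x| := by
      have := (hu i).continuous.measurable
      have : Measurable (E.indicator (1 : X → ℝ)) := measurable_one.indicator hE
      fun_prop
    dsimp only
    rw [← lintegral_add_left hm]
    refine lintegral_mono fun x => ?_
    rw [← ENNReal.ofReal_add (abs_nonneg _) (abs_nonneg _)]
    refine ENNReal.ofReal_le_ofReal ?_
    have hind : (E ∪ F).indicator (1 : X → ℝ) x = max (E.indicator 1 x) (F.indicator 1 x) := by
      by_cases h1 : x ∈ E <;> by_cases h2 : x ∈ F <;> simp [h1, h2]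
    rw [hind]
    exact (abs_max_sub_max_le_max _ _ _ _).trans
      (max_le_add_of_nonneg (abs_nonneg _) (abs_nonneg _))
  · calc ∫⁻ x, lipSlope (fun y => max (u i y) (v i y)) x ∂μ
        ≤ ∫⁻ x, (lipSlope (u i) x + lipSlope (v i) x) ∂μ :=
          lintegral_mono fun x => lipSlope_sup_le _ _ x
      _ = ∫⁻ x, lipSlope (u i) x ∂μ + ∫⁻ x, lipSlope (v i) x ∂μ :=
          lintegral_add_left (measurable_lipSlope (hu i).continuous) _
      _ ≤ (Perim μ E + ε / 2) + (Perim μ F + ε / 2) := add_le_add (hul i).le (hvl i).le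
      _ = Perim μ E + Perim μ F + ε := by
          rw [add_add_add_comm, ENNReal.add_halves]

/-- Lower semicontinuity of the perimeter under `L¹` convergence on balls. -/
theorem perim_le_liminf [LocallyCompactSpace X] [TopologicalSpace.SeparableSpace X] {μ : Measure X}
    {E : ℕ → Set X} {F : Set X} (hE : ∀ k, MeasurableSet (E k)) (hF : MeasurableSet F)
    (hconv : ∀ (y : X) (ρ : ℝ), 0 < ρ →
      TendstoL1On μ (ball y ρ) (fun k => (E k).indicator 1) (F.indicator 1)) :
    Perim μ F ≤ liminf (fun k => Perim μ (E k)) atTop := by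
  have := UniformSpace.secondCountable_of_separable X
  refine le_of_forall_gt_imp_ge_of_dense fun c hc => ?_
  obtain ⟨θ, hθ, hθlt⟩ := extraction_of_frequently_atTop
    (frequently_lt_of_liminf_lt (by isBoundedDefault) hc)
  let K : CompactExhaustion X := default
  have happrox (n : ℕ) : ∃ w : X → ℝ, LocLipschitzOn w univ ∧ ∫⁻ x, lipSlope w x ∂μ < c ∧
      ∫⁻ x in K n, ENNReal.ofReal |w x - (E (θ n)).indicator 1 x| ∂μ < ((n : ℝ≥0∞) + 1)⁻¹ := by
    obtain ⟨u, hu, huE, hul⟩ := exists_approx_of_perim_lt (hθlt n)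
    obtain ⟨i, hi⟩ := ((huE (K n) (subset_univ _) (K.isCompact n)).eventually_lt_const
      (ENNReal.inv_pos.2 (by finiteness : ((n : ℝ≥0∞) + 1) ≠ ⊤))).exists
    exact ⟨u i, hu i, hul i, hi⟩
  choose w hw hwc hwd using happrox
  refine perim_le_of_approx hw (fun C _ hC => ?_) fun i => (hwc i).le
  obtain ⟨m, hm⟩ := K.exists_superset_of_isCompact hC
  rcases C.eq_empty_or_nonempty with rfl | ⟨y, -⟩
  · simp [TendstoL1On]
  obtain ⟨ρ, hρ, hCρ⟩ := hC.isBounded.subset_ball_lt 0 y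
  have hinv : Tendsto (fun n : ℕ => ((n : ℝ≥0∞) + 1)⁻¹) atTop (𝓝 0) := by
    have := (tendsto_add_atTop_iff_nat 1).2 ENNReal.tendsto_inv_nat_nhds_zero
    simpa using this
  have hsum := hinv.add ((hconv y ρ hρ).comp hθ.tendsto_atTop)
  rw [add_zero] at hsum
  refine tendsto_of_tendsto_of_tendsto_of_le_of_le' tendsto_const_nhds hsum
    (Eventually.of_forall fun _ => zero_le) ?_
  filter_upwards [eventually_ge_atTop m] with n hn
  refine (lintegral_abs_sub_le (w n) (measurable_one.indicator (hE (θ n)))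
    (measurable_one.indicator hF)).trans (add_le_add ?_ ?_)
  · exact (lintegral_mono_set (hm.trans (K.subset hn))).trans (hwd n).le
  · exact lintegral_mono_set hCρ

theorem exists_deriv_le_div {m : ℝ → ℝ} (hm : Monotone m) {a b M : ℝ} (hab : a < b)
    (hM : m b - m a ≤ M) {N : Set ℝ} (hN : volume (N ∩ Ioo a b) = 0) :
    ∃ r ∈ Ioo a b, r ∉ N ∧ deriv m r ≤ M / (b - a) := by
  have hmon : MonotoneOn m (uIcc a b) := hm.monotoneOn _
  have hint : Integrable (deriv m) (volume.restrict (Ioo a b)) := by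
    have := hmon.intervalIntegrable_deriv
    rw [intervalIntegrable_iff_integrableOn_Ioo_of_le hab.le] at this
    exact this
  have hne : volume.restrict (Ioo a b) ≠ 0 := by
    rw [Ne, Measure.restrict_eq_zero]
    simpa using hab
  have hnull : volume.restrict (Ioo a b) (N ∪ (Ioo a b)ᶜ) = 0 := by
    refine measure_union_null ?_ ?_
    · rwa [Measure.restrict_apply' measurableSet_Ioo]
    · rw [Measure.restrict_apply' measurableSet_Ioo]; simp
  obtain ⟨r, hr, hle⟩ := exists_notMem_null_le_average hne hint hnull
  simp only [mem_union, mem_compl_iff, not_or, not_not] at hr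
  refine ⟨r, hr.2, hr.1, hle.trans ?_⟩
  have hI := hmon.intervalIntegral_deriv_mem_uIcc
  rw [uIcc_of_le (sub_nonneg.2 (hm hab.le)), intervalIntegral.integral_of_le hab.le,
    integral_Ioc_eq_integral_Ioo] at hI
  rw [setAverage_eq, smul_eq_mul, Real.volume_real_Ioo_of_le hab.le, div_eq_inv_mul]
  exact mul_le_mul_of_nonneg_left (hI.2.trans hM) (by simpa using hab.le)

/-- Averaging the cut property over an interval produces a radius at which cutting by a ball
costs little perimeter. -/
theorem exists_cut_radius [OpensMeasurableSpace X] {μ : Measure X} (hcut : CutProperty μ)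
    {E : Set X} (hE : MeasurableSet E) (hμE : μ E ≠ ⊤) (hPE : Perim μ E ≠ ⊤) (o : X) {a b : ℝ}
    (ha : 0 ≤ a) (hab : a < b) :
    ∃ r ∈ Ioo a b, Perim μ (E ∩ ball o r) + Perim μ (E \ ball o r) ≤
      Perim μ E + 2 * ENNReal.ofReal ((μ E).toReal / (b - a)) := by
  have hm : Monotone fun s => (μ (E ∩ ball o s)).toReal := fun s t hst =>
    ENNReal.toReal_mono (measure_ne_top_of_subset inter_subset_left hμE)
      (measure_mono (inter_subset_inter_right _ (ball_subset_ball hst)))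
  have hM : (μ (E ∩ ball o b)).toReal - (μ (E ∩ ball o a)).toReal ≤ (μ E).toReal :=
    (sub_le_self _ ENNReal.toReal_nonneg).trans
      (ENNReal.toReal_mono hμE (measure_mono inter_subset_left))
  have hnull := hcut E hE hPE o
  rw [ae_iff, Measure.restrict_apply' measurableSet_Ioi] at hnull
  obtain ⟨r, hr, hrN, hle⟩ := exists_deriv_le_div hm hab hM
    (measure_mono_null (inter_subset_inter_right _ fun s hs => ha.trans_lt hs.1) hnull)
  simp only [mem_ofPred_eq, not_not] at hrN
  refine ⟨r, hr, (add_le_add hrN.1 hrN.2).trans ?_⟩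
  rw [add_add_add_comm, ← two_mul]
  have hdisj : Disjoint (ball o r) (closure (ball o r))ᶜ :=
    disjoint_compl_right_iff_subset.2 subset_closure
  gcongr
  exact perim_add_perim_le μ E isClosed_closure.isOpen_compl hdisj

theorem isoProfile_le_liminf_perim {μ : Measure X}
    (hfin : ∀ v ∈ profileDomain μ, isoProfile μ v ≠ ⊤)
    (hcont : ContinuousOn (fun v : ℝ => (isoProfile μ v).toReal) (profileDomain μ))
    {V : ℝ} (hV : V ∈ profileDomain μ) {F : ℕ → Set X} (hF : ∀ k, MeasurableSet (F k))
    (hvol : Tendsto (fun k => μ (F k)) atTop (𝓝 (ENNReal.ofReal V))) :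
    isoProfile μ V ≤ liminf (fun k => Perim μ (F k)) atTop := by
  have hopen : IsOpen (profileDomain μ) :=
    isOpen_Ioi.inter (isOpen_Iio.preimage ENNReal.continuous_ofReal)
  have hreal : Tendsto (fun k => (μ (F k)).toReal) atTop (𝓝 V) := by
    simpa [ENNReal.toReal_ofReal hV.1.le, Function.comp_def] using
      (ENNReal.tendsto_toReal ENNReal.ofReal_ne_top).comp hvol
  have hdom : ∀ᶠ k in atTop, (μ (F k)).toReal ∈ profileDomain μ :=
    hreal.eventually (hopen.mem_nhds hV)
  have hprof : Tendsto (fun k => isoProfile μ (μ (F k)).toReal) atTop (𝓝 (isoProfile μ V)) := by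
    have h := ENNReal.tendsto_ofReal
      ((hcont.continuousAt (hopen.mem_nhds hV)).tendsto.comp hreal)
    rw [ENNReal.ofReal_toReal (hfin V hV)] at h
    refine h.congr' ?_
    filter_upwards [hdom] with k hk
    exact ENNReal.ofReal_toReal (hfin _ hk)
  rw [← hprof.liminf_eq]
  refine liminf_le_liminf ?_
  filter_upwards [hvol.eventually_lt_const ENNReal.ofReal_lt_top] with k hk
  exact iInf_le_of_le (F k) (iInf₂_le (hF k) (ENNReal.ofReal_toReal hk.ne).symm)

theorem tendsto_measure_inter_ball [OpensMeasurableSpace X] (μ : Measure X) (E : Set X)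
    (o : X) {s : ℕ → ℝ} (hs : Tendsto s atTop atTop) :
    Tendsto (fun k => μ (E ∩ ball o (s k))) atTop (𝓝 (μ E)) := by
  have hmono : Monotone fun t : ℝ => E ∩ ball o t := fun t t' h =>
    inter_subset_inter_right _ (ball_subset_ball h)
  have h := tendsto_measure_iUnion_atTop (μ := μ) hmono
  have hU : ⋃ t : ℝ, E ∩ ball o t = E := by
    refine subset_antisymm (iUnion_subset fun _ => inter_subset_left) fun y hy => ?_
    exact mem_iUnion.2 ⟨dist y o + 1, hy, mem_ball.2 (lt_add_one _)⟩
  rw [hU] at h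
  exact h.comp hs

/-- A diagonal subsequence of a sequence with bounded volumes and perimeters, converging to its
limit set on balls of linearly growing radii. -/
theorem exists_diagonal_subsequence {μ : Measure X} (hH1 : BVCompactness μ) (x : X)
    {Ω : ℕ → Set X} (hΩ : ∀ k, MeasurableSet (Ω k)) {a b : ℝ≥0∞} (ha : a ≠ ⊤) (hb : b ≠ ⊤)
    (hvol : Tendsto (fun k => μ (Ω k)) atTop (𝓝 a))
    (hper : Tendsto (fun k => Perim μ (Ω k)) atTop (𝓝 b)) :
    ∃ φ : ℕ → ℕ, StrictMono φ ∧ ∃ F : Set X, MeasurableSet F ∧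
      (∀ (y : X) (ρ : ℝ), 0 < ρ →
        TendstoL1On μ (ball y ρ) (fun k => (Ω (φ k)).indicator 1) (F.indicator 1)) ∧
      (∀ n : ℕ, μ (symmDiff (Ω (φ n)) F ∩ ball x (3 * ((n : ℝ) + 1))) ≤ ((n : ℝ≥0∞) + 1)⁻¹) ∧
      (∀ n, μ (Ω (φ n)) ≠ ⊤) ∧ ∀ n, Perim μ (Ω (φ n)) ≠ ⊤ := by
  have hab : a + b < a + b + 1 := ENNReal.lt_add_right (by finiteness) one_ne_zero
  obtain ⟨N, hN⟩ := eventually_atTop.1 ((hvol.add hper).eventually_lt_const hab)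
  have hbound (i : ℕ) : μ (Ω (i + N)) + Perim μ (Ω (i + N)) < ⊤ :=
    (hN _ (Nat.le_add_left N i)).trans (by finiteness)
  obtain ⟨ψ, hψ, F, hF, hconv⟩ := hH1 (fun i => Ω (i + N)) (fun i => hΩ _)
    ⟨a + b + 1, by finiteness, fun i => (hN _ (Nat.le_add_left N i)).le⟩
  have hev (n : ℕ) : ∀ᶠ k in atTop,
      μ (symmDiff (Ω (ψ k + N)) F ∩ ball x (3 * ((n : ℝ) + 1))) ≤ ((n : ℝ≥0∞) + 1)⁻¹ := by
    have h := (hconv x (3 * ((n : ℝ) + 1)) (by positivity)).eventually_lt_const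
      (ENNReal.inv_pos.2 (by finiteness : ((n : ℝ≥0∞) + 1) ≠ ⊤))
    filter_upwards [h] with k hk
    rw [lintegral_indicator_sub_eq (hΩ _) hF] at hk
    exact hk.le
  obtain ⟨θ, hθ, hθle⟩ := extraction_forall_of_eventually hev
  exact ⟨fun n => ψ (θ n) + N, fun m n h => Nat.add_lt_add_right (hψ (hθ h)) N, F, hF,
    fun y ρ hρ => (hconv y ρ hρ).comp hθ.tendsto_atTop, hθle,
    fun n => (ENNReal.add_lt_top.1 (hbound _)).1.ne, fun n => (ENNReal.add_lt_top.1 (hbound _)).2.ne⟩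

theorem measure_inter_le_add_symmDiff {Y : Type*} [MeasurableSpace Y] (μ : Measure Y)
    (E F B : Set Y) : μ (E ∩ B) ≤ μ (F ∩ B) + μ (symmDiff E F ∩ B) := by
  refine (measure_mono fun y hy => ?_).trans (measure_union_le _ _)
  by_cases h : y ∈ F
  · exact Or.inl ⟨h, hy.2⟩
  · exact Or.inr ⟨Or.inl ⟨hy.1, h⟩, hy.2⟩

theorem tendsto_measure_inter_ball_of_symmDiff [OpensMeasurableSpace X] {μ : Measure X}
    {W : ℕ → Set X} {F : Set X} {x : X} {r : ℕ → ℝ} (hr : Tendsto r atTop atTop)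
    (hd : Tendsto (fun n => μ (symmDiff (W n) F ∩ ball x (r n))) atTop (𝓝 0)) :
    Tendsto (fun n => μ (W n ∩ ball x (r n))) atTop (𝓝 (μ F)) := by
  have hF := tendsto_measure_inter_ball μ F x hr
  have hlow : Tendsto (fun n => μ (F ∩ ball x (r n)) - μ (symmDiff (W n) F ∩ ball x (r n)))
      atTop (𝓝 (μ F)) := by
    simpa using ENNReal.Tendsto.sub hF hd (Or.inr ENNReal.zero_ne_top)
  have hup := hF.add hd
  rw [add_zero] at hup
  refine tendsto_of_tendsto_of_tendsto_of_le_of_le hlow hup (fun n => ?_)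
    fun n => measure_inter_le_add_symmDiff μ _ _ _
  rw [tsub_le_iff_right, symmDiff_comm]
  exact measure_inter_le_add_symmDiff μ _ _ _

theorem tendsto_ofReal_div_succ_zero (c : ℝ) :
    Tendsto (fun n : ℕ => 2 * ENNReal.ofReal (c / ((n : ℝ) + 1))) atTop (𝓝 0) := by
  have h := (tendsto_add_atTop_iff_nat 1).2 (tendsto_const_div_atTop_nhds_zero_nat c)
  have h2 := ENNReal.Tendsto.const_mul (a := 2) (ENNReal.tendsto_ofReal h)
    (Or.inr (by norm_num))
  simpa using h2

/-- Replacing the converging part of a splitting by any competitor of the same volume does not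
decrease the perimeter in the limit. -/
theorem isoProfile_le_perim_add_liminf [OpensMeasurableSpace X] {μ : Measure X}
    (hcut : CutProperty μ) (hfin : ∀ v ∈ profileDomain μ, isoProfile μ v ≠ ⊤)
    (hcont : ContinuousOn (fun v : ℝ => (isoProfile μ v).toReal) (profileDomain μ))
    {x : X} {V : ℝ} (hV : V ∈ profileDomain μ) {D : ℕ → Set X} (hD : ∀ k, MeasurableSet (D k))
    (hDball : ∀ n : ℕ, Disjoint (ball x (2 * ((n : ℝ) + 1))) (D n)) {E : Set X}
    (hE : MeasurableSet E) (hμE : μ E ≠ ⊤)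
    (hvol : Tendsto (fun k => μ E + μ (D k)) atTop (𝓝 (ENNReal.ofReal V))) :
    isoProfile μ V ≤ Perim μ E + liminf (fun k => Perim μ (D k)) atTop := by
  by_cases hPE : Perim μ E = ⊤
  · simp [hPE]
  have hs (n : ℕ) := exists_cut_radius hcut hE hμE hPE x
    (show (0 : ℝ) ≤ (n : ℝ) + 1 by positivity) (show (n : ℝ) + 1 < 2 * ((n : ℝ) + 1) by linarith)
  choose s hs hsP using hs
  have hst : Tendsto s atTop atTop :=
    tendsto_atTop_mono (fun n => by linarith [(hs n).1]) tendsto_natCast_atTop_atTop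
  let F : ℕ → Set X := fun n => (E ∩ ball x (s n)) ∪ D n
  have hdisj (n : ℕ) : Disjoint (E ∩ ball x (s n)) (D n) :=
    (hDball n).mono_left (inter_subset_right.trans (ball_subset_ball (hs n).2.le))
  have hFm (n : ℕ) : MeasurableSet (F n) := (hE.inter measurableSet_ball).union (hD n)
  have hFvol : Tendsto (fun n => μ (F n)) atTop (𝓝 (ENNReal.ofReal V)) := by
    have h1 : Tendsto (fun n => (μ E + μ (D n)) - μ (E \ ball x (s n))) atTop
        (𝓝 (ENNReal.ofReal V)) := by
      have h2 : Tendsto (fun n => μ (E \ ball x (s n))) atTop (𝓝 0) := by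
        have h3 := ENNReal.Tendsto.sub (tendsto_const_nhds (x := μ E))
          (tendsto_measure_inter_ball μ E x hst) (Or.inl hμE)
        rw [tsub_self] at h3
        refine h3.congr fun n => ?_
        rw [← measure_sdiff inter_subset_left (hE.inter measurableSet_ball).nullMeasurableSet
          (measure_ne_top_of_subset inter_subset_left hμE), sdiff_self_inter]
      simpa using ENNReal.Tendsto.sub hvol h2 (Or.inr ENNReal.zero_ne_top)
    refine h1.congr fun n => ?_
    rw [measure_union (hdisj n) (hD n), ← measure_inter_add_sdiff E measurableSet_ball,
      add_right_comm]
    exact ENNReal.add_sub_cancel_right (measure_ne_top_of_subset sdiff_subset hμE)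
  refine (isoProfile_le_liminf_perim hfin hcont hV hFm hFvol).trans ?_
  have hle : ∀ n, Perim μ (F n) ≤
      (Perim μ E + Perim μ (D n)) + 2 * ENNReal.ofReal ((μ E).toReal / ((n : ℝ) + 1)) := fun n => by
    refine (perim_union_le μ (hE.inter measurableSet_ball)).trans ?_
    rw [add_right_comm]
    gcongr
    refine le_self_add.trans ((hsP n).trans_eq ?_)
    ring_nf
  refine (liminf_le_liminf (Eventually.of_forall hle)).trans ?_
  refine (ENNReal.liminf_add_of_right_tendsto_zero (tendsto_ofReal_div_succ_zero _) _).le.trans ?_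
  simp only [add_comm (Perim μ E)]
  exact (liminf_add_const atTop _ _ (by isBoundedDefault) (by isBoundedDefault)).le

/-- If both parts of a splitting satisfy sharp lower bounds, the first one converges. -/
theorem ENNReal.tendsto_of_add_tendsto {u v : ℕ → ℝ≥0∞} {p a : ℝ≥0∞} (ha : a ≠ ⊤)
    (hsum : Tendsto (fun n => u n + v n) atTop (𝓝 a)) (hp : p ≤ liminf u atTop)
    (hle : a ≤ p + liminf v atTop) : Tendsto u atTop (𝓝 p) := by
  have h := ENNReal.limsup_add_liminf_le u v
  rw [hsum.limsup_eq] at h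
  exact tendsto_of_le_liminf_of_limsup_le hp
    ((ENNReal.add_le_add_iff_right (ne_top_of_le_ne_top ha (le_add_self.trans h))).1
      (h.trans hle))

/-- **Mass splitting of perimeter-minimizing sequences with converging (not fixed)
volumes.** Let `(X, d, μ)` be a noncompact metric measure space satisfying (H1)–(H5),
and assume moreover that the isoperimetric profile `I_X` is real-valued and continuous
on `(0, μ(X))`. Fix `x ∈ X` and `V ∈ (0, μ(X))`, and let `Ω_k ⊆ X` be Borel sets with
`lim_k μ(Ω_k) = V` and `lim_k P(Ω_k) = I_X(V)`. Then, up to passing to a subsequence,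
there exist a set of finite perimeter `Ω ⊆ X` and a diverging sequence of radii
`r_k → +∞` such that, setting `Ω_k^c := Ω_k ∩ B_{r_k}(x)` and `Ω_k^d := Ω_k ∖ B_{r_k}(x)`:
(i) `lim_k (P(Ω_k^c) + P(Ω_k^d)) = I_X(V)`;
(ii) `χ_{Ω_k^c} → χ_Ω` in `L¹(B, μ)` for every ball `B ⊆ X`;
(iii) `Ω` is an isoperimetric region, i.e. `P(Ω) = I_X(μ(Ω))`, and moreover
`lim_k μ(Ω_k^c) = μ(Ω)` and `lim_k P(Ω_k^c) = P(Ω)`. -/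
theorem mass_splitting_of_minimizing_sequences_converging_volumes
    {X : Type*} [MetricSpace X] [MeasurableSpace X] [BorelSpace X]
    [LocallyCompactSpace X] [TopologicalSpace.SeparableSpace X] [NoncompactSpace X]
    (μ : Measure X) (hfin : FiniteOnBounded μ) (hsupp : FullSupport μ)
    (hH1 : BVCompactness μ) (hH2 : CutProperty μ) (hH3 : SmallBallPerimeter μ)
    (hH4 : BallVolContinuous μ) (hH5 : UnifLocDoubling μ)
    (hIfin : ∀ v ∈ profileDomain μ, isoProfile μ v ≠ ⊤)
    (hIcont : ContinuousOn (fun v : ℝ => (isoProfile μ v).toReal) (profileDomain μ))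
    (x : X) (V : ℝ) (hV : V ∈ profileDomain μ)
    (Ω : ℕ → Set X) (hΩmeas : ∀ k, MeasurableSet (Ω k))
    (hΩvol : Tendsto (fun k => μ (Ω k)) atTop (𝓝 (ENNReal.ofReal V)))
    (hΩmin : Tendsto (fun k => Perim μ (Ω k)) atTop (𝓝 (isoProfile μ V))) :
    ∃ φ : ℕ → ℕ, StrictMono φ ∧
    ∃ Ωlim : Set X, MeasurableSet Ωlim ∧ Perim μ Ωlim ≠ ⊤ ∧
    ∃ r : ℕ → ℝ, Tendsto r atTop atTop ∧
      -- (i)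
      (Tendsto
        (fun k => Perim μ (Ω (φ k) ∩ ball x (r k)) + Perim μ (Ω (φ k) \ ball x (r k)))
        atTop (𝓝 (isoProfile μ V))) ∧
      -- (ii)
      (∀ (y : X) (ρ : ℝ), 0 < ρ →
        TendstoL1On μ (ball y ρ)
          (fun k => (Ω (φ k) ∩ ball x (r k)).indicator 1) (Ωlim.indicator 1)) ∧
      -- (iii)
      Perim μ Ωlim = isoProfile μ ((μ Ωlim).toReal) ∧
      (Tendsto (fun k => μ (Ω (φ k) ∩ ball x (r k))) atTop (𝓝 (μ Ωlim))) ∧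
      (Tendsto (fun k => Perim μ (Ω (φ k) ∩ ball x (r k))) atTop (𝓝 (Perim μ Ωlim))) := by
  have hIV := hIfin V hV
  obtain ⟨φ, hφ, F, hF, hconv, hdiff, hμW, hPW⟩ := exists_diagonal_subsequence hH1 x hΩmeas
    ENNReal.ofReal_ne_top hIV hΩvol hΩmin
  have hWvol := hΩvol.comp hφ.tendsto_atTop
  have hWmin := hΩmin.comp hφ.tendsto_atTop
  have hr (n : ℕ) := exists_cut_radius hH2 (hΩmeas (φ n)) (hμW n) (hPW n) x
    (show (0 : ℝ) ≤ 2 * ((n : ℝ) + 1) by positivity)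
    (show 2 * ((n : ℝ) + 1) < 3 * ((n : ℝ) + 1) by linarith)
  choose r hr hrP using hr
  have hrt : Tendsto r atTop atTop :=
    tendsto_atTop_mono (fun n => by linarith [(hr n).1, (Nat.cast_nonneg n : (0 : ℝ) ≤ n)])
      tendsto_natCast_atTop_atTop
  have hconv' (y : X) (ρ : ℝ) (hρ : 0 < ρ) : TendstoL1On μ (ball y ρ)
      (fun k => (Ω (φ k) ∩ ball x (r k)).indicator 1) (F.indicator 1) := by
    refine (hconv y ρ hρ).congr' ?_
    filter_upwards [hrt.eventually_ge_atTop (ρ + dist y x)] with k hk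
    refine setLIntegral_congr_fun measurableSet_ball fun z hz => ?_
    have hzr : z ∈ ball x (r k) := ball_subset_ball' hk hz
    by_cases h : z ∈ Ω (φ k) <;> simp [h, hzr, -mem_ball]
  have hdiff0 : Tendsto (fun n => μ (symmDiff (Ω (φ n)) F ∩ ball x (r n))) atTop (𝓝 0) := by
    have hinv : Tendsto (fun n : ℕ => ((n : ℝ≥0∞) + 1)⁻¹) atTop (𝓝 0) := by
      simpa using (tendsto_add_atTop_iff_nat 1).2 ENNReal.tendsto_inv_nat_nhds_zero
    refine tendsto_of_tendsto_of_tendsto_of_le_of_le tendsto_const_nhds hinv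
      (fun _ => zero_le) fun n => (measure_mono ?_).trans (hdiff n)
    exact inter_subset_inter_right _ (ball_subset_ball (hr n).2.le)
  have hcvol := tendsto_measure_inter_ball_of_symmDiff hrt hdiff0
  have hFV : μ F ≤ ENNReal.ofReal V :=
    le_of_tendsto_of_tendsto' hcvol hWvol fun n => measure_mono inter_subset_left
  have hμF : μ F ≠ ⊤ := ne_top_of_le_ne_top ENNReal.ofReal_ne_top hFV
  have hcm (n : ℕ) : MeasurableSet (Ω (φ n) ∩ ball x (r n)) :=
    (hΩmeas _).inter measurableSet_ball
  have hdm (n : ℕ) : MeasurableSet (Ω (φ n) \ ball x (r n)) :=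
    (hΩmeas _).diff measurableSet_ball
  have hdvol : Tendsto (fun n => μ F + μ (Ω (φ n) \ ball x (r n))) atTop
      (𝓝 (ENNReal.ofReal V)) := by
    have h := ENNReal.Tendsto.sub hWvol hcvol (Or.inl ENNReal.ofReal_ne_top)
    have h' := (tendsto_const_nhds (x := μ F)).add h
    rw [add_tsub_cancel_of_le hFV] at h'
    refine h'.congr fun n => ?_
    rw [Function.comp_apply,
      ← measure_inter_add_sdiff (Ω (φ n)) (measurableSet_ball (x := x) (ε := r n)),
      ENNReal.add_sub_cancel_left (measure_ne_top_of_subset inter_subset_left (hμW n))]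
  have hsum : Tendsto
      (fun k => Perim μ (Ω (φ k) ∩ ball x (r k)) + Perim μ (Ω (φ k) \ ball x (r k)))
      atTop (𝓝 (isoProfile μ V)) := by
    have hμlt : ENNReal.ofReal V < ENNReal.ofReal (V + 1) :=
      (ENNReal.ofReal_lt_ofReal_iff (by linarith [hV.1])).2 (by linarith)
    have hup := hWmin.add (tendsto_ofReal_div_succ_zero (V + 1))
    rw [add_zero] at hup
    refine tendsto_of_tendsto_of_tendsto_of_le_of_le' hWmin hup
      (Eventually.of_forall fun n => ?_) ?_
    · simpa [inter_union_sdiff] using perim_union_le μ (hcm n) (F := Ω (φ n) \ ball x (r n))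
    · filter_upwards [hWvol.eventually_lt_const hμlt] with n hn
      refine (hrP n).trans ?_
      have hlen : 3 * ((n : ℝ) + 1) - 2 * ((n : ℝ) + 1) = (n : ℝ) + 1 := by ring
      rw [hlen, Function.comp_apply]
      gcongr
      exact ENNReal.toReal_le_of_le_ofReal (by linarith [hV.1]) hn.le
  have hlsc := perim_le_liminf hcm hF hconv'
  have hcomp {E : Set X} (hE : MeasurableSet E) (hEF : μ E = μ F) : isoProfile μ V ≤
      Perim μ E + liminf (fun k => Perim μ (Ω (φ k) \ ball x (r k))) atTop :=
    isoProfile_le_perim_add_liminf hH2 hIfin hIcont (x := x) hV hdm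
      (fun n => disjoint_sdiff_right.mono_left (ball_subset_ball (hr n).1.le)) hE (hEF ▸ hμF)
      (by rwa [hEF])
  have hlow : Perim μ F + liminf (fun k => Perim μ (Ω (φ k) \ ball x (r k))) atTop ≤
      isoProfile μ V := by
    rw [← hsum.liminf_eq]
    exact (add_le_add_left hlsc _).trans (ENNReal.liminf_add_liminf_le _ _)
  refine ⟨φ, hφ, F, hF, ne_top_of_le_ne_top hIV (le_self_add.trans hlow), r, hrt, hsum, hconv',
    le_antisymm ?_ ?_, hcvol, ENNReal.tendsto_of_add_tendsto hIV hsum hlsc (hcomp hF rfl)⟩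
  · refine le_iInf fun E => le_iInf₂ fun hE hEF => ?_
    rw [ENNReal.ofReal_toReal hμF] at hEF
    exact (ENNReal.add_le_add_iff_right
      (ne_top_of_le_ne_top hIV (le_add_self.trans hlow))).1 (hlow.trans (hcomp hE hEF))
  · exact iInf_le_of_le F (iInf₂_le hF (ENNReal.ofReal_toReal hμF).symm)

end
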